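/- Let p be a prime and let F be a filtration V(0) ⊆ ... ⊆ V(n) = V of a finite-dimensional F_p[Z/p]-module V by submodules. Define the filtration F_{Z/p} of the coinvariants V_{Z/p} by V_{Z/p}(k) = (soc(V(k) + rad(V)) + V(k−1) + rad(V))/rad(V). Then e(F) ≤ e(F_{Z/p}), where for a filtration G of a space of dimension r with subquotient dimensions c_k, e(G) = Σ_k c_k (2p^k − 1). -/

import Mathlib

variable {p : ℕ} {V : Type} [AddCommGroup V] [Module (ZMod p) V]

/-- `rad(V) = ⟨v - σv⟩`. -/
def radOf (σ : V →ₗ[ZMod p] V) : Submodule (ZMod p) V := LinearMap.range (σ - 1)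

/-- `soc(W) = W^{Z/p}`, the `σ`-fixed vectors of `W`. -/
def socOf (σ : V →ₗ[ZMod p] V) (W : Submodule (ZMod p) V) : Submodule (ZMod p) V :=
  W ⊓ LinearMap.ker (σ - 1)

/-- The filtration `F_{Z/p}` of the coinvariants `V_{Z/p} = V/rad(V)`:
`V_{Z/p}(k) = (soc(V(k) + rad(V)) + V(k-1) + rad(V))/rad(V)`. -/
def coinvFilt (σ : V →ₗ[ZMod p] V) (F : ℕ → Submodule (ZMod p) V) (k : ℕ) :
    Submodule (ZMod p) (V ⧸ radOf σ) :=
  Submodule.map (radOf σ).mkQ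
    (socOf σ (F k ⊔ radOf σ) ⊔ (if k = 0 then ⊥ else F (k - 1)) ⊔ radOf σ)

/-- `e(G) = Σ_k c_k(G) (2p^k - 1)` for a filtration `G` read off through stage `N`,
where `c_k(G) = dim G(k)/G(k-1)`. -/
noncomputable def eOf (p : ℕ) {W : Type} [AddCommGroup W] [Module (ZMod p) W]
    (G : ℕ → Submodule (ZMod p) W) (N : ℕ) : ℕ :=
  ∑ k ∈ Finset.range (N + 1),
    (Module.finrank (ZMod p) ↥(G k) - (if k = 0 then 0 else Module.finrank (ZMod p) ↥(G (k - 1))))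
      * (2 * p ^ k - 1)

theorem aux_abel (n : ℕ) : ∀ (w : ℕ → ℤ) (_ : Monotone w) (d : ℕ → ℤ)
    (_ : ∀ k ≤ n, 0 ≤ ∑ j ∈ Finset.Ico k (n + 1), d j),
    w 0 * ∑ k ∈ Finset.range (n + 1), d k ≤ ∑ k ∈ Finset.range (n + 1), d k * w k := by
  induction n with
  | zero => intro w _ d _; simp [mul_comm]
  | succ n ih =>
    intro w hw d hd
    have h1 := ih (fun k => w (k + 1)) (fun a b h => hw (by omega)) (fun k => d (k + 1)) (by
      intro k hk
      have := hd (k + 1) (by omega)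
      rwa [← Finset.sum_Ico_add' d k (n + 1) 1] at this)
    rw [Finset.sum_range_succ' _ (n + 1), Finset.sum_range_succ' _ (n + 1)]
    have h2 := hd 1 (by omega)
    rw [← Finset.sum_Ico_add' d 0 (n + 1) 1, ← Finset.range_eq_Ico] at h2
    have h3 : w 0 ≤ w 1 := hw (by omega)
    simp only [zero_add] at h1
    nlinarith [mul_le_mul_of_nonneg_right h3 h2]

theorem aux_compl {K W : Type*} [Field K] [AddCommGroup W] [Module K W] [FiniteDimensional K W]
    (S Q : Submodule K W) : ∃ B ≤ S, S ⊔ Q = B ⊔ Q ∧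
      Module.finrank K B + Module.finrank K Q = Module.finrank K ↥(S ⊔ Q) := by
  obtain ⟨C, h1, h2⟩ := exists_isCompl (S ⊓ Q)
  have hS : S = (S ⊓ Q) ⊔ (S ⊓ C) := by
    have h3 : (S ⊓ Q) ⊔ C ⊓ S = ((S ⊓ Q) ⊔ C) ⊓ S := (sup_inf_assoc_of_le C inf_le_left).symm
    rw [inf_comm S C, h3, codisjoint_iff.1 h2, top_inf_eq]
  have hsup : S ⊔ Q = S ⊓ C ⊔ Q := by
    apply le_antisymm
    · refine sup_le ?_ le_sup_right
      conv_lhs => rw [hS]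
      exact sup_le (inf_le_right.trans le_sup_right) le_sup_left
    · exact sup_le_sup_right inf_le_left _
  refine ⟨S ⊓ C, inf_le_left, hsup, ?_⟩
  have h4 : S ⊓ C ⊓ Q = ⊥ := by
    rw [eq_bot_iff, ← disjoint_iff.1 h1]
    exact le_inf (le_inf (inf_le_left.trans inf_le_left) inf_le_right)
      (inf_le_left.trans inf_le_right)
  have h5 := Submodule.finrank_sup_add_finrank_inf_eq (S ⊓ C) Q
  rw [h4, finrank_bot] at h5
  rw [hsup]; omega

theorem aux_finsup {K W ι : Type*} [Field K] [AddCommGroup W] [Module K W] [FiniteDimensional K W]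
    (s : Finset ι) (C : ι → Submodule K W) (m : ι → ℕ) (h : ∀ i ∈ s, Module.finrank K (C i) ≤ m i) :
    Module.finrank K ↥(s.sup C) ≤ ∑ i ∈ s, m i := by
  classical
  induction s using Finset.induction_on with
  | empty => simp
  | insert a s ha ih =>
    rw [Finset.sup_insert, Finset.sum_insert ha]
    have := Submodule.finrank_add_le_finrank_add_finrank (C a) (s.sup C)
    have := h a (by simp)
    have := ih (fun i hi => h i (by simp [hi]))
    omega

theorem aux_nil {p : ℕ} [Fact p.Prime] {V : Type} [AddCommGroup V] [Module (ZMod p) V]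
    (σ : V →ₗ[ZMod p] V) (hσ : σ ^ p = 1) : (σ - 1) ^ p = 0 := by
  have h : ((Polynomial.X - 1 : Polynomial (ZMod p)) ^ p) = Polynomial.X ^ p - 1 := by
    rw [sub_pow_char, one_pow]
  have := congrArg (Polynomial.aeval (R := ZMod p) (A := Module.End (ZMod p) V) σ) h
  simp only [map_pow, map_sub, Polynomial.aeval_X, map_one] at this
  rw [this]
  exact sub_eq_zero.2 hσ

theorem aux_finrank_map {K W : Type*} [Field K] [AddCommGroup W] [Module K W]
    [FiniteDimensional K W] (R P : Submodule K W) (h : R ≤ P) :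
    Module.finrank K (P.map R.mkQ) + Module.finrank K R = Module.finrank K P := by
  have h1 := LinearMap.finrank_range_add_finrank_ker (R.mkQ.domRestrict P)
  rw [LinearMap.range_domRestrict] at h1
  have h2 : LinearMap.ker (R.mkQ.domRestrict P) = R.submoduleOf P := by
    ext x; simp [Submodule.submoduleOf]
  rw [h2, (Submodule.submoduleOfEquivOfLe h).finrank_eq] at h1
  exact h1

/-- spanning -/
theorem aux_span {K W : Type*} [Field K] [AddCommGroup W] [Module K W]
    (N : W →ₗ[K] W) (p : ℕ) (hN : N ^ p = 0) (A B T : Submodule K W)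
    (htop : A ⊔ B ⊔ LinearMap.range N = ⊤)
    (hB : ∀ x ∈ B, ∃ z, N x = N (N z)) (hBT : B ≤ T)
    (hA : ∀ j < p, ∀ x ∈ A, (N ^ j) x ∈ T) : T = ⊤ := by
  have step : ∀ i < p, ∀ v, ∃ t ∈ T, ∃ z, (N ^ i) v = t + (N ^ (i + 1)) z := by
    intro i hi v
    have hv : v ∈ A ⊔ B ⊔ LinearMap.range N := htop ▸ Submodule.mem_top
    obtain ⟨y, hy, r, ⟨u, rfl⟩, rfl⟩ := Submodule.mem_sup.1 hv
    obtain ⟨a, ha, b, hb, rfl⟩ := Submodule.mem_sup.1 hy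
    rcases i with _ | i
    · exact ⟨a + b, T.add_mem (by simpa using hA 0 hi a ha) (hBT hb), u, by simp⟩
    · obtain ⟨z, hz⟩ := hB b hb
      refine ⟨_, hA (i + 1) hi a ha, z + u, ?_⟩
      have e1 : (N ^ (i + 1)) b = (N ^ (i + 1 + 1)) z := by
        rw [pow_succ, pow_succ, pow_succ]; simp [Module.End.mul_apply, hz]
      have e2 : (N ^ (i + 1)) (N u) = (N ^ (i + 1 + 1)) u := by
        rw [pow_succ N (i + 1)]; simp [Module.End.mul_apply]
      rw [map_add, map_add, map_add, e1, e2]; abel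
  have all : ∀ i ≤ p, ∀ v, ∃ t ∈ T, ∃ z, v = t + (N ^ i) z := by
    intro i
    induction i with
    | zero => intro _ v; exact ⟨0, T.zero_mem, v, by simp⟩
    | succ i ih =>
      intro hi v
      obtain ⟨t, ht, z, hz⟩ := ih (by omega) v
      obtain ⟨t', ht', z', hz'⟩ := step i (by omega) z
      exact ⟨t + t', T.add_mem ht ht', z', by rw [hz, hz', add_assoc]⟩
  rw [eq_top_iff]
  intro v _
  obtain ⟨t, ht, z, hz⟩ := all p le_rfl v
  rw [hz, hN]; simpa using ht

theorem aux_P {p : ℕ} {V : Type} [AddCommGroup V] [Module (ZMod p) V]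
    (σ : V →ₗ[ZMod p] V) (F Q : Submodule (ZMod p) V) :
    socOf σ (F ⊔ radOf σ) ⊔ Q ⊔ radOf σ =
      (F ⊓ (LinearMap.range ((σ - 1) * (σ - 1))).comap (σ - 1)) ⊔ (Q ⊔ radOf σ) := by
  rw [← sup_assoc]
  apply le_antisymm
  · refine sup_le (sup_le ?_ (le_sup_right.trans le_sup_left)) le_sup_right
    rintro v ⟨h1, h2⟩
    obtain ⟨x, hx, y, ⟨z, rfl⟩, rfl⟩ := Submodule.mem_sup.1 h1
    have h2' : (σ - 1) (x + (σ - 1) z) = 0 := h2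
    refine add_mem (Submodule.mem_sup_left (Submodule.mem_sup_left ⟨hx, ?_⟩))
      (Submodule.mem_sup_right ⟨z, rfl⟩)
    refine ⟨-z, ?_⟩
    rw [map_add] at h2'
    rw [map_neg, Module.End.mul_apply]
    exact (eq_neg_of_add_eq_zero_left h2').symm
  · refine sup_le (sup_le ?_ (le_sup_right.trans le_sup_left)) le_sup_right
    rintro x ⟨h1, ⟨z, hz⟩⟩
    have : x = (x - (σ - 1) z) + (σ - 1) z := by abel
    rw [this]
    refine add_mem (Submodule.mem_sup_left (Submodule.mem_sup_left ⟨?_, ?_⟩))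
      (Submodule.mem_sup_right ⟨z, rfl⟩)
    · exact sub_mem (Submodule.mem_sup_left h1) (Submodule.mem_sup_right ⟨z, rfl⟩)
    · change (σ - 1) (x - (σ - 1) z) = 0
      rw [map_sub, sub_eq_zero, ← hz]; rfl


theorem aux_num (p n : ℕ) (hp : 1 ≤ p) (f g P q a b : ℕ → ℕ) (r : ℕ) (hf : Monotone f)
    (hq0 : q 0 = r) (hb : ∀ k, b k + q k = P k) (ha : ∀ k, a k + P k = q (k + 1))
    (hg : ∀ k, g k + r = P k)
    (hall : f n ≤ ∑ l ∈ Finset.range (n + 1), (b l + p * a l))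
    (htail : ∀ k < n, f n ≤ f k + ∑ l ∈ Finset.Ico (k + 1) (n + 1), (b l + p * a l)) :
    ∑ k ∈ Finset.range (n + 1), (f k - (if k = 0 then 0 else f (k - 1))) * (2 * p ^ k - 1) ≤
    ∑ k ∈ Finset.range (n + 1 + 1), (g k - (if k = 0 then 0 else g (k - 1))) * (2 * p ^ k - 1) := by
  have hpow : ∀ k, 1 ≤ p ^ k := fun k => Nat.one_le_pow _ _ hp
  let w : ℕ → ℤ := fun k => 2 * (p : ℤ) ^ k - 1
  have hwc : ∀ k, ((2 * p ^ k - 1 : ℕ) : ℤ) = w k := by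
    intro k
    have := hpow k
    rw [Nat.cast_sub (by omega)]; push_cast; rfl
  have hp' : (1 : ℤ) ≤ p := by exact_mod_cast hp
  have hw : Monotone w := by
    apply monotone_nat_of_le_succ
    intro k
    have : (p : ℤ) ^ k ≤ p ^ (k + 1) := pow_le_pow_right₀ hp' (by omega)
    simp only [w]; linarith
  have hw0 : ∀ k, 0 ≤ w k := fun k => by rw [← hwc]; positivity
  have hpw : ∀ k, (p : ℤ) * w k ≤ w (k + 1) := by
    intro k; simp only [w, pow_succ]; nlinarith
  let c : ℕ → ℤ := fun k => (f k : ℤ) - (if k = 0 then 0 else (f (k - 1) : ℤ))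
  have hc : ∀ k, ((f k - (if k = 0 then 0 else f (k - 1)) : ℕ) : ℤ) = c k := by
    intro k
    rcases k with _ | k
    · simp [c]
    · have := hf (Nat.le_succ k)
      simp only [c]
      simp only [Nat.succ_eq_add_one] at this
      simp [Nat.cast_sub this]
  have hcs : ∀ m, ∑ k ∈ Finset.range (m + 1), c k = f m := by
    intro m
    induction m with
    | zero => simp [c]
    | succ m ih => rw [Finset.sum_range_succ, ih]; simp [c]
  let m : ℕ → ℤ := fun k => (b k : ℤ) + p * a k
  have hd : ∀ k ≤ n, 0 ≤ ∑ j ∈ Finset.Ico k (n + 1), (m j - c j) := by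
    intro k hk
    rw [Finset.sum_sub_distrib]
    rcases k with _ | k
    · rw [← Finset.range_eq_Ico, hcs]
      have : (f n : ℤ) ≤ ∑ l ∈ Finset.range (n + 1), m l := by
        simp only [m]; exact_mod_cast hall
      linarith
    · have h1 := Finset.sum_range_add_sum_Ico c (show k + 1 ≤ n + 1 by omega)
      rw [hcs, hcs] at h1
      have : (f n : ℤ) ≤ f k + ∑ l ∈ Finset.Ico (k + 1) (n + 1), m l := by
        simp only [m]; exact_mod_cast htail k (by omega)
      linarith
  have key := aux_abel n w hw (fun k => m k - c k) hd
  have h0 := hd 0 (by omega)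
  rw [← Finset.range_eq_Ico] at h0
  have key2 := (mul_nonneg (hw0 0) h0).trans key
  simp only [sub_mul, Finset.sum_sub_distrib] at key2
  rw [← Nat.cast_le (α := ℤ), Nat.cast_sum, Nat.cast_sum]
  simp only [Nat.cast_mul, hwc, hc]
  have hG : ∑ k ∈ Finset.range (n + 1 + 1),
      (((g k - (if k = 0 then 0 else g (k - 1)) : ℕ) : ℤ)) * w k =
      ∑ k ∈ Finset.range (n + 1 + 1), (b k : ℤ) * w k
        + ∑ k ∈ Finset.range (n + 1), (a k : ℤ) * w (k + 1) := by
    rw [Finset.sum_range_succ' _ (n + 1), Finset.sum_range_succ' (fun k => (b k : ℤ) * w k) (n + 1)]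
    have e0 : g 0 = b 0 := by have := hg 0; have := hb 0; omega
    have e1 : ∀ k, g (k + 1) - g k = b (k + 1) + a k := by
      intro k
      have := hg k; have := hg (k + 1); have := hb (k + 1); have := ha k; omega
    simp only [Nat.add_eq_zero_iff, one_ne_zero, and_false, if_false, Nat.add_sub_cancel, e1, e0,
      if_true, Nat.sub_zero]
    push_cast
    simp only [add_mul, Finset.sum_add_distrib]
    ring
  rw [hG, Finset.sum_range_succ (fun k => (b k : ℤ) * w k) (n + 1)]
  have hb' : 0 ≤ (b (n + 1) : ℤ) * w (n + 1) := mul_nonneg (by positivity) (hw0 _)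
  have hm : ∑ k ∈ Finset.range (n + 1), m k * w k ≤ ∑ k ∈ Finset.range (n + 1), (b k : ℤ) * w k
        + ∑ k ∈ Finset.range (n + 1), (a k : ℤ) * w (k + 1) := by
    rw [← Finset.sum_add_distrib]
    apply Finset.sum_le_sum
    intro k _
    have : (a k : ℤ) * (p * w k) ≤ a k * w (k + 1) :=
      mul_le_mul_of_nonneg_left (hpw k) (by positivity)
    simp only [m]; linarith
  linarith

/-- For a filtration `F : V(0) ⊆ … ⊆ V(n) = V` of a finite-dimensional
`F_p[Z/p]`-module `V` by submodules, one has `e(F) ≤ e(F_{Z/p})`, where `F_{Z/p}` is the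
filtration of the coinvariants defined by
`V_{Z/p}(k) = (soc(V(k) + rad V) + V(k-1) + rad V)/rad V` (which exhausts `V_{Z/p}`
at stage `n + 1`). -/
theorem stmt8 (p : ℕ) [Fact p.Prime] (V : Type) [AddCommGroup V] [Module (ZMod p) V]
    [FiniteDimensional (ZMod p) V] (σ : V →ₗ[ZMod p] V) (hσ : σ ^ p = 1)
    (n : ℕ) (F : ℕ → Submodule (ZMod p) V) (hmono : Monotone F)
    (hinv : ∀ k, ∀ x ∈ F k, σ x ∈ F k) (htop : F n = ⊤) :
    eOf p F n ≤ eOf p (coinvFilt σ F) (n + 1) := by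
  let N := σ - 1
  have hN : N ^ p = 0 := aux_nil σ hσ
  let R := radOf σ
  let Q0 : ℕ → Submodule (ZMod p) V := fun k => if k = 0 then ⊥ else F (k - 1)
  let S : ℕ → Submodule (ZMod p) V := fun k =>
    F k ⊓ (LinearMap.range ((σ - 1) * (σ - 1))).comap (σ - 1)
  let Q : ℕ → Submodule (ZMod p) V := fun k => Q0 k ⊔ R
  let P : ℕ → Submodule (ZMod p) V := fun k => socOf σ (F k ⊔ R) ⊔ Q0 k ⊔ R
  have hP : ∀ k, P k = S k ⊔ Q k := fun k => aux_P σ (F k) (Q0 k)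
  have hQ1 : ∀ k, Q (k + 1) = F k ⊔ R := by intro k; simp [Q, Q0]
  have hQ0 : Q 0 = R := by simp [Q, Q0]
  have hQ0F : ∀ k, Q0 k ≤ F k := by
    intro k
    rcases k with _ | k
    · simp [Q0]
    · simpa [Q0] using hmono (Nat.le_succ k)
  have hFP : ∀ k, F k ⊔ P k = Q (k + 1) := by
    intro k
    rw [hQ1, hP]
    apply le_antisymm
    · exact sup_le le_sup_left (sup_le (inf_le_left.trans le_sup_left)
        (sup_le_sup_right (hQ0F k) _))
    · exact sup_le_sup_left (le_sup_right.trans le_sup_right) _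
  choose B hBS hB hBr using fun k => aux_compl (S k) (Q k)
  choose A hAF hA hAr using fun k => aux_compl (F k) (P k)
  have hNinv : ∀ k, ∀ x ∈ F k, N x ∈ F k := fun k x hx => sub_mem (hinv k x hx) hx
  have hNpow : ∀ k j, ∀ x ∈ F k, (N ^ j) x ∈ F k := by
    intro k j
    induction j with
    | zero => intro x hx; simpa using hx
    | succ j ih => intro x hx; rw [pow_succ]; exact ih _ (hNinv k x hx)
  let C : ℕ → Submodule (ZMod p) V := fun l =>
    B l ⊔ (Finset.range p).sup (fun j => (A l).map (N ^ j))
  have hCF : ∀ l, C l ≤ F l := by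
    intro l
    refine sup_le ((hBS l).trans inf_le_left) (Finset.sup_le fun j _ => ?_)
    rintro _ ⟨x, hx, rfl⟩
    exact hNpow l j x (hAF l hx)
  have hCr : ∀ l, Module.finrank (ZMod p) (C l) ≤
      Module.finrank (ZMod p) (B l) + p * Module.finrank (ZMod p) (A l) := by
    intro l
    have h1 := Submodule.finrank_add_le_finrank_add_finrank (B l)
      ((Finset.range p).sup (fun j => (A l).map (N ^ j)))
    have h2 := aux_finsup (Finset.range p) (fun j => (A l).map (N ^ j))
      (fun _ => Module.finrank (ZMod p) (A l)) (fun j _ => Submodule.finrank_map_le _ _)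
    simp only [Finset.sum_const, Finset.card_range, smul_eq_mul] at h2
    exact h1.trans (by omega)
  let A' := (Finset.range (n + 1)).sup A
  let B' := (Finset.range (n + 1)).sup B
  let T := (Finset.range (n + 1)).sup C
  have hgen : ∀ k ≤ n + 1, Q k ≤ A' ⊔ B' ⊔ R := by
    intro k
    induction k with
    | zero => intro _; rw [hQ0]; exact le_sup_right
    | succ k ih =>
      intro hk
      have hmem : k ∈ Finset.range (n + 1) := by simp; omega
      rw [← hFP, hA, hP, hB]
      refine sup_le ?_ (sup_le ?_ (ih (by omega)))
      · exact (Finset.le_sup (f := A) hmem).trans (le_sup_left.trans le_sup_left)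
      · exact (Finset.le_sup (f := B) hmem).trans (le_sup_right.trans le_sup_left)
  have hT : T = ⊤ := by
    refine aux_span N p hN A' B' T ?_ ?_ ?_ ?_
    · have h1 := hgen (n + 1) le_rfl
      rw [hQ1, htop, top_sup_eq] at h1
      exact top_le_iff.1 h1
    · have : B' ≤ (LinearMap.range ((σ - 1) * (σ - 1))).comap (σ - 1) :=
        Finset.sup_le fun l _ => (hBS l).trans inf_le_right
      intro x hx
      obtain ⟨z, hz⟩ := this hx
      exact ⟨z, hz.symm⟩
    · exact Finset.sup_le fun l hl =>
        le_sup_left.trans (Finset.le_sup (f := C) hl)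
    · intro j hj
      have : A' ≤ T.comap (N ^ j) := by
        refine Finset.sup_le fun l hl => ?_
        rw [← Submodule.map_le_iff_le_comap]
        refine le_trans ?_ (Finset.le_sup (f := C) hl)
        exact le_sup_of_le_right
          (Finset.le_sup (f := fun j => (A l).map (N ^ j)) (Finset.mem_range.2 hj))
      exact fun x hx => this hx
  unfold eOf
  refine aux_num p n (Fact.out : p.Prime).one_le (fun k => Module.finrank (ZMod p) (F k))
    (fun k => Module.finrank (ZMod p) (coinvFilt σ F k))
    (fun k => Module.finrank (ZMod p) (P k)) (fun k => Module.finrank (ZMod p) (Q k))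
    (fun k => Module.finrank (ZMod p) (A k)) (fun k => Module.finrank (ZMod p) (B k))
    (Module.finrank (ZMod p) R) (fun a b h => Submodule.finrank_mono (hmono h)) ?_ ?_ ?_ ?_ ?_ ?_
  · beta_reduce; rw [hQ0]
  · intro k
    beta_reduce; rw [hP]; exact hBr k
  · intro k
    beta_reduce; rw [← hFP]; exact hAr k
  · intro k
    exact aux_finrank_map R (P k) le_sup_right
  · have h1 := aux_finsup (Finset.range (n + 1)) C _ (fun l _ => hCr l)
    change Module.finrank (ZMod p) T ≤ _ at h1
    rw [hT] at h1
    beta_reduce; rw [htop]; exact h1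
  · intro k hk
    have h1 := aux_finsup (Finset.Ico (k + 1) (n + 1)) C _ (fun l _ => hCr l)
    have h2 := Submodule.finrank_add_le_finrank_add_finrank (F k)
      ((Finset.Ico (k + 1) (n + 1)).sup C)
    have h3 : F k ⊔ (Finset.Ico (k + 1) (n + 1)).sup C = ⊤ := by
      rw [eq_top_iff, ← hT]
      refine Finset.sup_le fun l hl => ?_
      rw [Finset.mem_range] at hl
      by_cases hlk : l ≤ k
      · exact (hCF l).trans ((hmono hlk).trans le_sup_left)
      · exact le_sup_of_le_right (Finset.le_sup (f := C) (Finset.mem_Ico.2 ⟨by omega, hl⟩))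
    rw [h3] at h2
    beta_reduce; rw [htop]
    exact h2.trans (by omega)
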